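/- Let d ≥ 2 and λ ∈ V satisfy 0 < E(λ) ≤ 1/2, and let ε > 0 satisfy ε ≤ e²·E(λ). Then there exists a natural number t such that η(F^(t)(λ)) ≤ ε and ∏_{k=0}^{t−1} c(F^(k)(λ)) ≤ 2e⁴·E(λ)/ε. -/

import Mathlib

open Finset

noncomputable section

/-- Membership in the set `V` of valid spectra (zero-indexed: `lam 0` is `λ₁`). -/
def memV {d : ℕ} [NeZero d] (lam : Fin d → ℝ) : Prop :=
  (∀ i, 0 ≤ lam i) ∧ (∀ i j : Fin d, i ≤ j → lam j ≤ lam i) ∧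
    lam 1 < lam 0 ∧ ∑ i, lam i = 1

/-- The spectrum map induced by a successful swap test:
`F(λ)_i = λ_i(λ_i+1)/(1+‖λ‖²)`. -/
def Fmap {d : ℕ} (lam : Fin d → ℝ) : Fin d → ℝ :=
  fun i => lam i * (lam i + 1) / (1 + ∑ j, lam j ^ 2)

/-- `E(λ) = Σ_{j=2}^d λ_j/(λ_1 - λ_j)`. -/
def Evec {d : ℕ} [NeZero d] (lam : Fin d → ℝ) : ℝ :=
  ∑ j ∈ Finset.univ.erase (0 : Fin d), lam j / (lam 0 - lam j)

/-- `η(λ) = 1 - λ₁`. -/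
def etaV {d : ℕ} [NeZero d] (lam : Fin d → ℝ) : ℝ := 1 - lam 0

/-- `c(λ) = 4/(1+‖λ‖²)`, the expected number of input samples consumed per
successful swap test on two copies of a state with spectrum `λ`. -/
def cV {d : ℕ} (lam : Fin d → ℝ) : ℝ := 4 / (1 + ∑ j, lam j ^ 2)

theorem memV.lt_apply_zero {d : ℕ} [NeZero d] {lam : Fin d → ℝ} (h : memV lam) {j : Fin d}
    (hj : j ≠ 0) : lam j < lam 0 :=
  (h.2.1 1 j (Fin.one_le_of_ne_zero hj)).trans_lt h.2.2.1

theorem one_add_sum_sq_pos {d : ℕ} (lam : Fin d → ℝ) : 0 < 1 + ∑ j, lam j ^ 2 :=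
  add_pos_of_pos_of_nonneg one_pos (sum_nonneg fun _ _ => sq_nonneg _)

theorem memV.sum_erase {d : ℕ} [NeZero d] {lam : Fin d → ℝ} (h : memV lam) :
    ∑ j ∈ univ.erase (0 : Fin d), lam j = etaV lam := by
  have := add_sum_erase univ lam (mem_univ (0 : Fin d))
  rw [h.2.2.2] at this
  unfold etaV
  linarith

theorem memV.etaV_nonneg {d : ℕ} [NeZero d] {lam : Fin d → ℝ} (h : memV lam) :
    0 ≤ etaV lam :=
  h.sum_erase ▸ sum_nonneg fun j _ => h.1 j

theorem memV.etaV_le_Evec {d : ℕ} [NeZero d] {lam : Fin d → ℝ} (h : memV lam) :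
    etaV lam ≤ Evec lam := by
  have h0 := h.etaV_nonneg
  rw [← h.sum_erase]
  refine sum_le_sum fun j hj => ?_
  have hlt := h.lt_apply_zero (ne_of_mem_erase hj)
  have hj0 := h.1 j
  rw [le_div_iff₀ (by linarith)]
  unfold etaV at h0
  nlinarith

theorem memV.fmap {d : ℕ} [NeZero d] {lam : Fin d → ℝ} (h : memV lam) : memV (Fmap lam) := by
  have hN := one_add_sum_sq_pos lam
  refine ⟨fun i => ?_, fun i j hij => ?_, ?_, ?_⟩
  · have := h.1 i
    unfold Fmap
    positivity
  · have hi := h.2.1 i j hij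
    have hj := h.1 j
    unfold Fmap
    gcongr
    linarith
  · have h1 := h.1 1
    have h10 := h.2.2.1
    unfold Fmap
    gcongr
  · unfold Fmap
    rw [← sum_div, div_eq_one_iff_eq hN.ne']
    simp only [mul_add, mul_one, sum_add_distrib, h.2.2.2, ← sq]
    ring

theorem memV.Evec_Fmap_le {d : ℕ} [NeZero d] {lam : Fin d → ℝ} (h : memV lam) :
    Evec (Fmap lam) ≤ Evec lam * ((1 + Evec lam) / 2) := by
  have key : Evec (Fmap lam) ≤ Evec lam * ((1 + etaV lam) / 2) := by
    unfold Evec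
    rw [sum_mul]
    refine sum_le_sum fun j hj => ?_
    have hN := one_add_sum_sq_pos lam
    have hlt := sub_pos.2 (h.lt_apply_zero (ne_of_mem_erase hj))
    have hj0 := h.1 j
    have h0 := h.1 0
    have hj1 : lam j ≤ etaV lam :=
      h.sum_erase ▸ single_le_sum (f := lam) (fun i _ => h.1 i) hj
    have hη := h.etaV_nonneg
    have heq : Fmap lam j / (Fmap lam 0 - Fmap lam j) =
        lam j / (lam 0 - lam j) * ((1 + lam j) / (1 + lam 0 + lam j)) := by
      unfold Fmap
      rw [← sub_div, div_div_div_cancel_right₀ hN.ne', div_mul_div_comm]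
      congr 1 <;> ring
    rw [heq]
    refine mul_le_mul_of_nonneg_left ?_ (by positivity)
    rw [div_le_div_iff₀ (by positivity) two_pos]
    unfold etaV at *
    nlinarith
  have hη := h.etaV_nonneg
  have hE := h.etaV_le_Evec
  refine key.trans ?_
  gcongr
  linarith

theorem memV.cV_le {d : ℕ} [NeZero d] {lam : Fin d → ℝ} (h : memV lam) :
    cV lam ≤ 2 * Real.exp (Evec lam) := by
  have hη := h.etaV_nonneg
  have hexp := (Real.quadratic_le_exp_of_nonneg hη).trans (Real.exp_le_exp.2 h.etaV_le_Evec)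
  have hsq : lam 0 ^ 2 ≤ ∑ j, lam j ^ 2 :=
    single_le_sum (f := fun j => lam j ^ 2) (fun i _ => sq_nonneg _) (mem_univ _)
  have hl : lam 0 = 1 - etaV lam := by unfold etaV; ring
  unfold cV
  rw [div_le_iff₀ (one_add_sum_sq_pos lam)]
  calc (4 : ℝ) ≤ 2 * (1 + etaV lam + etaV lam ^ 2 / 2) * (1 + lam 0 ^ 2) := by
        rw [hl]
        nlinarith [sq_nonneg (etaV lam ^ 2)]
    _ ≤ _ := by gcongr

theorem memV.iterate_Fmap_bounds {d : ℕ} [NeZero d] {lam : Fin d → ℝ} (h : memV lam)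
    (hE : Evec lam ≤ 1 / 2) (t : ℕ) :
    memV (Fmap^[t] lam) ∧ Evec (Fmap^[t] lam) ≤ 1 / 2 ∧
      ∑ k ∈ range t, Evec (Fmap^[k] lam) + 4 * Evec (Fmap^[t] lam) ≤ 4 * Evec lam ∧
      Evec (Fmap^[t] lam) * 2 ^ t ≤
        Evec lam * Real.exp (∑ k ∈ range t, Evec (Fmap^[k] lam)) ∧
      ∏ k ∈ range t, cV (Fmap^[k] lam) ≤
        2 ^ t * Real.exp (∑ k ∈ range t, Evec (Fmap^[k] lam)) := by
  induction t with
  | zero => exact ⟨h, hE, by simp, by simp, by simp⟩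
  | succ t ih =>
    obtain ⟨hm, hhalf, hS, hEt, hP⟩ := ih
    have hE₀ := h.etaV_nonneg.trans h.etaV_le_Evec
    have hE0 := hm.etaV_nonneg.trans hm.etaV_le_Evec
    have hstep := hm.Evec_Fmap_le
    have hexp := Real.add_one_le_exp (Evec (Fmap^[t] lam))
    rw [Function.iterate_succ_apply', sum_range_succ, prod_range_succ, Real.exp_add]
    refine ⟨hm.fmap, by nlinarith, by nlinarith, ?_, ?_⟩
    · calc Evec (Fmap (Fmap^[t] lam)) * 2 ^ (t + 1)
          ≤ Evec (Fmap^[t] lam) * ((1 + Evec (Fmap^[t] lam)) / 2) * 2 ^ (t + 1) := by gcongr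
        _ = Evec (Fmap^[t] lam) * 2 ^ t * (Evec (Fmap^[t] lam) + 1) := by ring
        _ ≤ Evec lam * Real.exp (∑ k ∈ range t, Evec (Fmap^[k] lam)) *
              Real.exp (Evec (Fmap^[t] lam)) := by gcongr
        _ = _ := by ring
    · have hc : 0 ≤ cV (Fmap^[t] lam) := div_nonneg (by norm_num) (one_add_sum_sq_pos _).le
      calc (∏ k ∈ range t, cV (Fmap^[k] lam)) * cV (Fmap^[t] lam)
          ≤ 2 ^ t * Real.exp (∑ k ∈ range t, Evec (Fmap^[k] lam)) *
              (2 * Real.exp (Evec (Fmap^[t] lam))) := by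
            gcongr
            exact hm.cV_le
        _ = _ := by ring

/-- expected cost of the third stage. -/
theorem stmt19 (d : ℕ) [NeZero d] (hd : 2 ≤ d) (lam : Fin d → ℝ) (hV : memV lam)
    (hE0 : 0 < Evec lam) (hE : Evec lam ≤ 1/2) (ε : ℝ) (hε : 0 < ε)
    (hεE : ε ≤ Real.exp 2 * Evec lam) :
    ∃ t : ℕ, etaV (Fmap^[t] lam) ≤ ε ∧
      ∏ k ∈ Finset.range t, cV (Fmap^[k] lam) ≤ 2 * Real.exp 4 * Evec lam / ε := by
  have hx : 1 ≤ Real.exp 2 * Evec lam / ε := (one_le_div hε).2 hεE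
  obtain ⟨n, hn, hn'⟩ := exists_nat_pow_near hx one_lt_two
  obtain ⟨hm, -, hS, hEt, hP⟩ := hV.iterate_Fmap_bounds hE (n + 1)
  have hE' := hm.etaV_nonneg.trans hm.etaV_le_Evec
  have hexp : Real.exp (∑ k ∈ range (n + 1), Evec (Fmap^[k] lam)) ≤ Real.exp 2 :=
    Real.exp_le_exp.2 (by linarith)
  refine ⟨n + 1, hm.etaV_le_Evec.trans ?_, hP.trans ?_⟩
  · rw [div_lt_iff₀ hε] at hn'
    have h2 : (0 : ℝ) < 2 ^ (n + 1) := by positivity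
    refine le_of_mul_le_mul_right (hEt.trans ?_) h2
    calc _ ≤ Evec lam * Real.exp 2 := by gcongr
      _ ≤ _ := by linarith
  · calc _ ≤ 2 * (Real.exp 2 * Evec lam / ε) * Real.exp 2 := by
          rw [pow_succ']
          gcongr
      _ = 2 * Real.exp (2 + 2) * Evec lam / ε := by
          rw [Real.exp_add]
          ring
      _ = _ := by norm_num
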